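/- Let n ≥ 1, let x̲ ≤ x̄ in ℝ≥0^n and let 𝐗 = ∏_{i=1}^n [x̲_i, x̄_i] be the corresponding nonempty closed interval (box) in ℝ≥0^n, and let C(𝐚) be an interval circulant matrix. Then for every A ∈ C(𝐚) there exists x ∈ 𝐗 with x ∈ Attr(A) (i.e., C(𝐚) is tolerance 𝐗-robust) if and only if Attr(A^{(k)}) ∩ 𝐗 ≠ ∅ for every k ∈ {0,…,n−1}. -/

import Mathlib

open scoped NNReal Classical

namespace MaxAlg

variable {n : ℕ}

/-- cyclic successor on `Fin k` -/
def cyc {k : ℕ} (l : Fin k) : Fin k := ⟨(l.val + 1) % k, Nat.mod_lt _ l.pos⟩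

/-- max-algebraic matrix product -/
noncomputable def mmul (A B : Matrix (Fin n) (Fin n) ℝ≥0) : Matrix (Fin n) (Fin n) ℝ≥0 :=
  fun i k => Finset.univ.sup fun j => A i j * B j k

/-- max-algebraic identity matrix -/
def mId (n : ℕ) : Matrix (Fin n) (Fin n) ℝ≥0 := fun i j => if i = j then 1 else 0

/-- max-algebraic matrix power -/
noncomputable def mpow (A : Matrix (Fin n) (Fin n) ℝ≥0) : ℕ → Matrix (Fin n) (Fin n) ℝ≥0
  | 0 => mId n
  | t + 1 => mmul (mpow A t) A

/-- max-algebraic matrix-vector product -/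
noncomputable def mvec (A : Matrix (Fin n) (Fin n) ℝ≥0) (x : Fin n → ℝ≥0) : Fin n → ℝ≥0 :=
  fun i => Finset.univ.sup fun j => A i j * x j

/-- geometric mean of the cycle `c` of length `k` -/
noncomputable def cycMean (A : Matrix (Fin n) (Fin n) ℝ≥0) (k : ℕ) (c : Fin k → Fin n) : ℝ≥0 :=
  (∏ l : Fin k, A (c l) (c (cyc l))) ^ ((1 : ℝ) / (k : ℝ))

/-- maximum cycle geometric mean λ(A) -/
noncomputable def lam (A : Matrix (Fin n) (Fin n) ℝ≥0) : ℝ≥0 :=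
  (Finset.Icc 1 n).sup fun k => Finset.univ.sup fun c : Fin k → Fin n => cycMean A k c

/-- attraction cone Attr(A) -/
def Attr (A : Matrix (Fin n) (Fin n) ℝ≥0) : Set (Fin n → ℝ≥0) :=
  {x | ∃ s : ℕ, mvec (mpow A (s + 1)) x = fun i => lam A * mvec (mpow A s) x i}

/-- circulant matrix built from the vector of values `a_0, …, a_{n-1}` -/
def circ (a : Fin n → ℝ≥0) : Matrix (Fin n) (Fin n) ℝ≥0 := fun i j => a (j - i)

/-- A is a circulant matrix -/
def IsCirculant (A : Matrix (Fin n) (Fin n) ℝ≥0) : Prop := ∃ a : Fin n → ℝ≥0, A = circ a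

/-- (i,j) is a critical edge of A -/
def IsCritEdge (A : Matrix (Fin n) (Fin n) ℝ≥0) (i j : Fin n) : Prop :=
  A i j ≠ 0 ∧ ∃ (k : ℕ) (c : Fin k → Fin n), 1 ≤ k ∧
    (∀ l, A (c l) (c (cyc l)) ≠ 0) ∧
    cycMean A k c = lam A ∧ ∃ l, c l = i ∧ c (cyc l) = j

/-- there is a walk of length ≥ 1 from i to j in crit(A) -/
def CritWalk (A : Matrix (Fin n) (Fin n) ℝ≥0) (i j : Fin n) : Prop :=
  ∃ l : ℕ, 1 ≤ l ∧ ∃ w : ℕ → Fin n, w 0 = i ∧ w l = j ∧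
    ∀ r < l, IsCritEdge A (w r) (w (r + 1))

/-- node i lies on a critical cycle of A -/
def OnCritCycle (A : Matrix (Fin n) (Fin n) ℝ≥0) (i : Fin n) : Prop :=
  ∃ (k : ℕ) (c : Fin k → Fin n), 1 ≤ k ∧
    (∀ l, A (c l) (c (cyc l)) ≠ 0) ∧
    cycMean A k c = lam A ∧ ∃ l, c l = i

/-- family of one-dimensional intervals with bounds `lo`, `hi`,
each of one of the four forms -/
def IsIntervalFam (S : Fin n → Set ℝ≥0) (lo hi : Fin n → ℝ≥0) : Prop :=
  ∀ i, (S i).Nonempty ∧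
    (S i = Set.Icc (lo i) (hi i) ∨ S i = Set.Ico (lo i) (hi i) ∨
     S i = Set.Ioc (lo i) (hi i) ∨ S i = Set.Ioo (lo i) (hi i))

/-- the interval 𝐗 ⊆ ℝ≥0ⁿ determined by the family S -/
def box (S : Fin n → Set ℝ≥0) : Set (Fin n → ℝ≥0) := {x | ∀ i, x i ∈ S i}

/-- vertex x^{(k)}: x̄ in coordinate k and x̲ elsewhere -/
def vtx (lo hi : Fin n → ℝ≥0) (k : Fin n) : Fin n → ℝ≥0 :=
  Function.update lo k (hi k)

/-- the interval circulant matrix C(𝐚) determined by the interval family Sa -/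
def Cset (Sa : Fin n → Set ℝ≥0) : Set (Matrix (Fin n) (Fin n) ℝ≥0) :=
  {A | ∃ a : Fin n → ℝ≥0, (∀ k, a k ∈ Sa k) ∧ A = circ a}

/-- the matrix Â, with â_k = min(a̲, ā_k) where a̲ = max_k a̲_k -/
noncomputable def Ahat (alo ahi : Fin n → ℝ≥0) : Matrix (Fin n) (Fin n) ℝ≥0 :=
  circ fun k => min (Finset.univ.sup alo) (ahi k)

/-- the matrix A^{(k)} = Circulant(a̲_0,…,a̲_{k−1}, ā_k, a̲_{k+1},…,a̲_{n−1}) -/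
def Ak (alo ahi : Fin n → ℝ≥0) (k : Fin n) : Matrix (Fin n) (Fin n) ℝ≥0 :=
  circ (Function.update alo k (ahi k))

lemma mvec_mId (x : Fin n → ℝ≥0) : mvec (mId n) x = x := by
  funext i
  refine le_antisymm (Finset.sup_le fun j _ => ?_) ?_
  · by_cases h : i = j <;> simp [mId, h]
  · refine le_trans ?_ (Finset.le_sup (f := fun j => mId n i j * x j) (Finset.mem_univ i))
    simp [mId]

lemma mvec_mmul (A B : Matrix (Fin n) (Fin n) ℝ≥0) (x : Fin n → ℝ≥0) :
    mvec (mmul A B) x = mvec A (mvec B x) := by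
  funext i
  simp only [mvec, mmul, NNReal.finset_sup_mul, NNReal.mul_finset_sup]
  rw [Finset.sup_comm]
  simp only [mul_assoc]

lemma mvec_mpow (A : Matrix (Fin n) (Fin n) ℝ≥0) (s : ℕ) (x : Fin n → ℝ≥0) :
    mvec (mpow A s) x = (mvec A)^[s] x := by
  induction s generalizing x with
  | zero => exact mvec_mId x
  | succ s ih => rw [mpow, mvec_mmul, ih, Function.iterate_succ_apply]

lemma mvec_mono (A : Matrix (Fin n) (Fin n) ℝ≥0) : Monotone (mvec A) := fun _ _ h _ =>
  Finset.sup_mono_fun fun j _ => mul_le_mul_right (h j) _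

lemma mvec_smul (A : Matrix (Fin n) (Fin n) ℝ≥0) (c : ℝ≥0) (x : Fin n → ℝ≥0) :
    mvec A (c • x) = c • mvec A x := by
  funext i
  simp only [mvec, Pi.smul_apply, smul_eq_mul, NNReal.mul_finset_sup]
  exact Finset.sup_congr rfl fun j _ => by ring

lemma iterate_mvec_smul (A : Matrix (Fin n) (Fin n) ℝ≥0) (c : ℝ≥0) (s : ℕ) (x : Fin n → ℝ≥0) :
    (mvec A)^[s] (c • x) = c • (mvec A)^[s] x := by
  induction s generalizing x with
  | zero => rfl
  | succ s ih => rw [Function.iterate_succ_apply, mvec_smul, ih, Function.iterate_succ_apply]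

lemma mem_Attr_iff (A : Matrix (Fin n) (Fin n) ℝ≥0) (x : Fin n → ℝ≥0) :
    x ∈ Attr A ↔ ∃ s : ℕ, (mvec A)^[s + 1] x = lam A • (mvec A)^[s] x := by
  simp only [Attr, Set.mem_ofPred_eq, mvec_mpow]
  rfl

lemma continuous_iterate_mvec_circ (s : ℕ) :
    Continuous fun p : (Fin n → ℝ≥0) × (Fin n → ℝ≥0) => (mvec (circ p.1))^[s] p.2 := by
  induction s with
  | zero => exact continuous_snd
  | succ s ih =>
    simp only [Function.iterate_succ_apply']
    refine continuous_pi fun i => ?_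
    refine Continuous.finset_sup_apply fun j _ => ?_
    exact ((continuous_apply (j - i)).comp continuous_fst).mul ((continuous_apply j).comp ih)

lemma exists_le_count (w : Multiset (Fin n)) (hw : n * n < w.card) : ∃ t, n ≤ w.count t := by
  by_contra! h
  have h₁ : ∑ t, w.count t = w.card := Multiset.sum_count_eq_card fun _ _ => Finset.mem_univ _
  have h₂ : ∑ t, w.count t ≤ n * n := by
    simpa using Finset.sum_le_card_nsmul Finset.univ (fun t => w.count t) n fun t _ => (h t).le
  omega

lemma mul_iterate_le_mul_iterate (a b : Fin n → ℝ≥0) (α β : ℝ≥0) (h : ∀ t, α * b t ≤ β * a t)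
    (s : ℕ) (x : Fin n → ℝ≥0) :
    α ^ s • (mvec (circ b))^[s] x ≤ β ^ s • (mvec (circ a))^[s] x := by
  induction s with
  | zero => simp
  | succ s ih =>
    rw [Function.iterate_succ_apply', Function.iterate_succ_apply']
    intro i
    have hstep : ∀ y, α • mvec (circ b) y ≤ β • mvec (circ a) y := fun y i => by
      simp only [Pi.smul_apply, smul_eq_mul, mvec, NNReal.mul_finset_sup, ← mul_assoc]
      exact Finset.sup_mono_fun fun j _ => mul_le_mul_left (h _) _
    calc (α ^ (s + 1) • mvec (circ b) ((mvec (circ b))^[s] x)) i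
        = (α • mvec (circ b) (α ^ s • (mvec (circ b))^[s] x)) i := by
          rw [mvec_smul, smul_smul, pow_succ']
      _ ≤ (β • mvec (circ a) (α ^ s • (mvec (circ b))^[s] x)) i := hstep _ i
      _ ≤ (β • mvec (circ a) (β ^ s • (mvec (circ a))^[s] x)) i :=
          mul_le_mul_right (mvec_mono _ ih i) _
      _ = _ := by rw [mvec_smul, smul_smul, ← pow_succ']

section Circulant

variable [NeZero n]

lemma nsmul_card_eq_zero (t : Fin n) : n • t = 0 := by
  simpa using card_nsmul_eq_zero (x := t)

lemma lam_circ (a : Fin n → ℝ≥0) : lam (circ a) = Finset.univ.sup a := by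
  refine le_antisymm (Finset.sup_le fun k hk => Finset.sup_le fun c _ => ?_)
    (Finset.sup_le fun t _ => ?_)
  · have hk0 : k ≠ 0 := by
      have := (Finset.mem_Icc.1 hk).1
      omega
    rw [cycMean, one_div, NNReal.rpow_inv_le_iff (by positivity), NNReal.rpow_natCast]
    calc _ ≤ ∏ _l : Fin k, Finset.univ.sup a :=
          Finset.prod_le_prod' fun l _ => Finset.le_sup (f := a) (Finset.mem_univ _)
      _ = _ := by simp
  · have hn : n ≠ 0 := NeZero.ne n
    let c : Fin n → Fin n := fun l => l.val • t
    have hc : cycMean (circ a) n c = a t := by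
      have h : ∀ l : Fin n, circ a (c l) (c (cyc l)) = a t := by
        intro l
        have : c (cyc l) = (l.val + 1) • t :=
          (nsmul_eq_mod_nsmul (l.val + 1) (nsmul_card_eq_zero t)).symm
        rw [circ, this, succ_nsmul, add_sub_cancel_left]
      simp only [cycMean, h, Finset.prod_const, Finset.card_univ, Fintype.card_fin, one_div]
      exact NNReal.pow_rpow_inv_natCast _ hn
    rw [← hc]
    refine le_trans ?_ (Finset.le_sup (b := n) (Finset.mem_Icc.2 ⟨by omega, le_rfl⟩))
    exact Finset.le_sup (f := fun c : Fin n → Fin n => cycMean (circ a) n c) (Finset.mem_univ c)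

lemma le_mvec_circ (a x : Fin n → ℝ≥0) (i t : Fin n) : a t * x (i + t) ≤ mvec (circ a) x i := by
  have := Finset.le_sup (f := fun j => circ a i j * x j) (Finset.mem_univ (i + t))
  simp only [circ, add_sub_cancel_left] at this
  exact this

lemma prod_mul_le_iterate (a x : Fin n → ℝ≥0) (w : Multiset (Fin n)) (i : Fin n) :
    (w.map a).prod * x (i + w.sum) ≤ (mvec (circ a))^[w.card] x i := by
  induction w using Multiset.induction_on generalizing i with
  | empty => simp
  | cons t w ih =>
    rw [Multiset.map_cons, Multiset.prod_cons, Multiset.sum_cons, Multiset.card_cons,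
      Function.iterate_succ_apply', mul_assoc, ← add_assoc]
    exact (mul_le_mul_right (ih (i + t)) _).trans (le_mvec_circ _ _ _ _)

lemma exists_iterate_eq (a x : Fin n → ℝ≥0) (s : ℕ) (i : Fin n) :
    ∃ w : Multiset (Fin n), w.card = s ∧
      (mvec (circ a))^[s] x i = (w.map a).prod * x (i + w.sum) := by
  induction s generalizing i with
  | zero => exact ⟨0, by simp⟩
  | succ s ih =>
    obtain ⟨j, -, hj⟩ := Finset.exists_mem_eq_sup Finset.univ ⟨i, Finset.mem_univ i⟩
      fun j => circ a i j * (mvec (circ a))^[s] x j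
    obtain ⟨w, hw, he⟩ := ih j
    refine ⟨(j - i) ::ₘ w, by simp [hw], ?_⟩
    rw [Function.iterate_succ_apply', mvec, hj, he, circ, Multiset.map_cons, Multiset.prod_cons,
      Multiset.sum_cons, mul_assoc, ← add_assoc, add_sub_cancel]

lemma pow_smul_iterate_le (a x : Fin n → ℝ≥0) (k : Fin n) (m s : ℕ) :
    a k ^ (n * m) • (mvec (circ a))^[s] x ≤ (mvec (circ a))^[s + n * m] x := by
  intro i
  obtain ⟨w, rfl, he⟩ := exists_iterate_eq a x s i
  have h := prod_mul_le_iterate a x (w + Multiset.replicate (n * m) k) i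
  simp only [Multiset.map_add, Multiset.map_replicate, Multiset.prod_add, Multiset.prod_replicate,
    Multiset.sum_add, Multiset.sum_replicate, Multiset.card_add, Multiset.card_replicate,
    mul_comm n m, mul_nsmul', nsmul_card_eq_zero, nsmul_zero, add_zero] at h
  rw [Pi.smul_apply, he, smul_eq_mul, ← mul_assoc, mul_comm (_ ^ _), mul_comm n m]
  exact h

lemma iterate_add_card (a x : Fin n → ℝ≥0) (s : ℕ) (hs : n * n ≤ s) :
    (mvec (circ a))^[s + n] x = (Finset.univ.sup a) ^ n • (mvec (circ a))^[s] x := by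
  have hn : 0 < n := Nat.pos_of_ne_zero (NeZero.ne n)
  apply le_antisymm
  · intro i
    obtain ⟨w, hw, he⟩ := exists_iterate_eq a x (s + n) i
    obtain ⟨t, ht⟩ := exists_le_count w (by omega)
    obtain ⟨v, rfl⟩ := Multiset.le_iff_exists_add.1 (Multiset.le_count_iff_replicate_le.1 ht)
    obtain rfl : v.card = s := by simpa [add_comm] using hw
    rw [he, Multiset.map_add, Multiset.prod_add, Multiset.sum_add, Multiset.map_replicate,
      Multiset.prod_replicate, Multiset.sum_replicate, nsmul_card_eq_zero, zero_add, mul_assoc]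
    exact mul_le_mul' (pow_le_pow_left' (Finset.le_sup (Finset.mem_univ t)) n)
      (prod_mul_le_iterate a x v i)
  · obtain ⟨k, -, hk⟩ := Finset.exists_mem_eq_sup Finset.univ ⟨0, Finset.mem_univ _⟩ a
    simpa [hk] using pow_smul_iterate_le a x k 1 s

lemma iterate_add_card_mul (a x : Fin n → ℝ≥0) (s m : ℕ) (hs : n * n ≤ s) :
    (mvec (circ a))^[s + n * m] x =
      (Finset.univ.sup a) ^ (n * m) • (mvec (circ a))^[s] x := by
  induction m with
  | zero => simp
  | succ m ih =>
    rw [mul_add, mul_one, ← add_assoc, iterate_add_card a x _ (by omega), ih, smul_smul, ← pow_add,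
      add_comm n]

/-- The transient of a circulant matrix is bounded by `n * n`, independently of its entries. -/
lemma mem_Attr_circ_iff (a x : Fin n → ℝ≥0) :
    x ∈ Attr (circ a) ↔ (mvec (circ a))^[n * n + 1] x =
      Finset.univ.sup a • (mvec (circ a))^[n * n] x := by
  rw [mem_Attr_iff, lam_circ]
  refine ⟨?_, fun h => ⟨_, h⟩⟩
  rintro ⟨s, hs⟩
  have hn : 1 ≤ n := Nat.pos_of_ne_zero (NeZero.ne n)
  have step : ∀ r, (mvec (circ a))^[r + s + 1] x =
      Finset.univ.sup a • (mvec (circ a))^[r + s] x := fun r => by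
    rw [add_assoc, Function.iterate_add_apply, hs, iterate_mvec_smul, ← Function.iterate_add_apply]
  rcases eq_or_ne (Finset.univ.sup a) 0 with h0 | h0
  · have hzero : ∀ y, mvec (circ a) y = 0 := fun y => by
      funext i
      refine le_antisymm (Finset.sup_le fun j _ => ?_) zero_le
      have : a (j - i) = 0 :=
        le_antisymm (h0 ▸ Finset.le_sup (f := a) (Finset.mem_univ _)) zero_le
      simp [circ, this]
    rw [Function.iterate_succ_apply', hzero, h0, zero_smul]
  · have hle : s ≤ n * s := Nat.le_mul_of_pos_left _ hn
    have h := step (n * n + n * s - s)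
    rw [Nat.sub_add_cancel (by omega), add_right_comm, iterate_add_card_mul a x _ s (by omega),
      iterate_add_card_mul a x _ s le_rfl, smul_comm] at h
    exact smul_right_injective _ (pow_ne_zero _ h0) h

/-- If `b` is dominated by `a` after normalising both by their maxima, and the maxima are
attained at a common index `k`, then `Attr (circ b) ⊆ Attr (circ a)`. -/
lemma Attr_circ_subset (a b : Fin n → ℝ≥0) (k : Fin n) (ha : Finset.univ.sup a = a k)
    (hb : Finset.univ.sup b = b k) (hak : 0 < a k) (hbk : 0 < b k)
    (h : ∀ t, a k * b t ≤ b k * a t) : Attr (circ b) ⊆ Attr (circ a) := by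
  intro x hx
  have hn : 1 ≤ n := Nat.pos_of_ne_zero (NeZero.ne n)
  rw [mem_Attr_circ_iff] at hx ⊢
  rw [hb] at hx
  rw [ha]
  set f := mvec (circ a) with hf
  set g := mvec (circ b) with hg
  set N := n * n with hN
  have fmono : ∀ s, Monotone f^[s] := fun s => (mvec_mono _).iterate s
  have hge : a k • f^[N] x ≤ f^[N + 1] x := by
    have h₁ : b k ^ N • x ≤ g^[N] x := by simpa using pow_smul_iterate_le b x k n 0
    have h₂ : b k ^ (N + 1) • x ≤ g^[N + 1] x := by
      rw [hx, pow_succ', mul_smul]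
      exact smul_le_smul_of_nonneg_left h₁ zero_le
    have h₃ := (smul_le_smul_of_nonneg_left h₂ (zero_le (a := a k ^ (N + 1)))).trans
      (mul_iterate_le_mul_iterate a b (a k) (b k) h (N + 1) x)
    have h₄ := fmono N h₃
    rw [iterate_mvec_smul, iterate_mvec_smul, iterate_mvec_smul, ← Function.iterate_add_apply,
      show N + (N + 1) = N + 1 + n * n by omega, iterate_add_card_mul a x (N + 1) n (by omega), ha,
      smul_comm, pow_succ (a k), mul_smul (a k ^ N)] at h₄
    rw [smul_le_smul_iff_of_pos_left (pow_pos hbk _),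
      smul_le_smul_iff_of_pos_left (pow_pos hak _)] at h₄
    exact h₄
  refine le_antisymm ?_ hge
  have hchain : ∀ j, a k ^ j • f^[N + 1] x ≤ f^[N + 1 + j] x := by
    intro j
    induction j with
    | zero => simp
    | succ j ih =>
      calc a k ^ (j + 1) • f^[N + 1] x = a k • a k ^ j • f^[N + 1] x := by
            rw [smul_smul, pow_succ']
        _ ≤ a k • f^[N + 1 + j] x := smul_le_smul_of_nonneg_left ih zero_le
        _ = f^[1 + j] (a k • f^[N] x) := by
            rw [iterate_mvec_smul, ← Function.iterate_add_apply,
              show 1 + j + N = N + 1 + j by omega]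
        _ ≤ f^[1 + j] (f^[N + 1] x) := fmono _ hge
        _ = f^[N + 1 + (j + 1)] x := by
            rw [← Function.iterate_add_apply,
              show 1 + j + (N + 1) = N + 1 + (j + 1) by omega]
  have hlast := hchain (n - 1)
  rw [show N + 1 + (n - 1) = N + n by omega, iterate_add_card a x N le_rfl, ha] at hlast
  rw [← pow_sub_one_mul (NeZero.ne n), mul_smul, smul_le_smul_iff_of_pos_left (pow_pos hak _)] at hlast
  exact hlast

lemma Attr_circ_zero : Attr (circ (0 : Fin n → ℝ≥0)) = Set.univ := by
  refine Set.eq_univ_of_forall fun x => (mem_Attr_iff _ _).2 ⟨0, ?_⟩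
  rw [lam_circ]
  funext i
  have h : Finset.univ.sup (0 : Fin n → ℝ≥0) = 0 := Finset.sup_bot _
  have h' : (Finset.univ.sup fun _ : Fin n => (0 : ℝ≥0)) = 0 := Finset.sup_bot _
  simp [mvec, circ, h, h']

lemma isClosed_setOf_Attr_circ_inter {X : Set (Fin n → ℝ≥0)} (hX : IsCompact X) :
    IsClosed {a : Fin n → ℝ≥0 | ∃ x ∈ X, x ∈ Attr (circ a)} := by
  have := isCompact_iff_compactSpace.1 hX
  have hcl : IsClosed {p : X × (Fin n → ℝ≥0) | (p.1 : Fin n → ℝ≥0) ∈ Attr (circ p.2)} := by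
    simp only [mem_Attr_circ_iff]
    have hc : ∀ s, Continuous fun p : X × (Fin n → ℝ≥0) =>
        (mvec (circ p.2))^[s] (p.1 : Fin n → ℝ≥0) := fun s =>
      (continuous_iterate_mvec_circ s).comp
        (continuous_snd.prodMk (continuous_subtype_val.comp continuous_fst))
    have hsup : Continuous fun p : X × (Fin n → ℝ≥0) => Finset.univ.sup p.2 :=
      Continuous.finset_sup_apply fun j _ => (continuous_apply j).comp continuous_snd
    exact isClosed_eq (hc _) (hsup.smul (hc _))
  convert isClosedMap_snd_of_compactSpace _ hcl using 1
  ext a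
  simp

end Circulant

lemma IsIntervalFam.endpoints_mem_closure {S : Fin n → Set ℝ≥0} {lo hi : Fin n → ℝ≥0}
    (hS : IsIntervalFam S lo hi) (i : Fin n) : lo i ∈ closure (S i) ∧ hi i ∈ closure (S i) := by
  obtain ⟨hne, h | h | h | h⟩ := hS i <;> rw [h] at hne ⊢
  · have hle := Set.nonempty_Icc.1 hne
    exact ⟨subset_closure ⟨le_rfl, hle⟩, subset_closure ⟨hle, le_rfl⟩⟩
  · have hlt := Set.nonempty_Ico.1 hne
    rw [closure_Ico hlt.ne]
    exact ⟨⟨le_rfl, hlt.le⟩, ⟨hlt.le, le_rfl⟩⟩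
  · have hlt := Set.nonempty_Ioc.1 hne
    rw [closure_Ioc hlt.ne]
    exact ⟨⟨le_rfl, hlt.le⟩, ⟨hlt.le, le_rfl⟩⟩
  · have hlt := Set.nonempty_Ioo.1 hne
    rw [closure_Ioo hlt.ne]
    exact ⟨⟨le_rfl, hlt.le⟩, ⟨hlt.le, le_rfl⟩⟩

lemma IsIntervalFam.subset_Icc {S : Fin n → Set ℝ≥0} {lo hi : Fin n → ℝ≥0}
    (hS : IsIntervalFam S lo hi) (i : Fin n) : S i ⊆ Set.Icc (lo i) (hi i) := by
  obtain ⟨-, h | h | h | h⟩ := hS i <;> rw [h]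
  exacts [Set.Ico_subset_Icc_self, Set.Ioc_subset_Icc_self, Set.Ioo_subset_Icc_self]

end MaxAlg
open MaxAlg in
/-- `C(𝐚)` is tolerance `𝐗`-robust (for a closed box `𝐗`) iff
`Attr(A⁽ᵏ⁾) ∩ 𝐗 ≠ ∅` for every `k`. -/
theorem tolerance_X_robust_iff
    (n : ℕ) (hn : 1 ≤ n)
    (lo hi : Fin n → ℝ≥0) (hX : ∀ i, lo i ≤ hi i)
    (Sa : Fin n → Set ℝ≥0) (alo ahi : Fin n → ℝ≥0) (hSa : IsIntervalFam Sa alo ahi)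
    (hle : ∀ k, alo k ≤ ahi k) :
    (∀ A ∈ Cset Sa, ∃ x ∈ {x : Fin n → ℝ≥0 | ∀ i, x i ∈ Set.Icc (lo i) (hi i)},
        x ∈ Attr A) ↔
      ∀ k : Fin n,
        (Attr (Ak alo ahi k) ∩
          {x : Fin n → ℝ≥0 | ∀ i, x i ∈ Set.Icc (lo i) (hi i)}).Nonempty := by
  have : NeZero n := ⟨by omega⟩
  constructor
  · intro h k
    have hcompact : IsCompact {x : Fin n → ℝ≥0 | ∀ i, x i ∈ Set.Icc (lo i) (hi i)} := by
      simpa [Set.pi] using isCompact_univ_pi fun i => isCompact_Icc (a := lo i) (b := hi i)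
    have hmem : Function.update alo k (ahi k) ∈ closure (Set.univ.pi Sa) := by
      rw [closure_pi_set]
      intro j _
      rcases eq_or_ne j k with rfl | hj
      · simpa using (hSa.endpoints_mem_closure j).2
      · simpa [hj] using (hSa.endpoints_mem_closure j).1
    obtain ⟨x, hx, hxA⟩ := closure_minimal
      (fun a (ha : a ∈ Set.univ.pi Sa) => h _ ⟨a, fun j => ha j (Set.mem_univ j), rfl⟩)
      (isClosed_setOf_Attr_circ_inter hcompact) hmem
    exact ⟨x, hxA, hx⟩
  · rintro h _ ⟨a, ha, rfl⟩
    have hle' := fun j => hSa.subset_Icc j (ha j)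
    obtain ⟨k, -, hk⟩ := Finset.exists_mem_eq_sup Finset.univ ⟨0, Finset.mem_univ _⟩ a
    have hmax : ∀ j, a j ≤ a k := fun j => hk ▸ Finset.le_sup (Finset.mem_univ j)
    rcases eq_or_ne (a k) 0 with h0 | h0
    · obtain rfl : a = 0 := funext fun j => le_antisymm ((hmax j).trans h0.le) zero_le
      exact ⟨lo, fun i => ⟨le_rfl, hX i⟩, by simp [Attr_circ_zero]⟩
    · obtain ⟨x, hxA, hx⟩ := h k
      have hpos : 0 < a k := pos_iff_ne_zero.2 h0
      refine ⟨x, hx, Attr_circ_subset a _ k hk ?_ hpos ?_ ?_ hxA⟩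
      · refine le_antisymm (Finset.sup_le fun j _ => ?_) (Finset.le_sup (Finset.mem_univ k))
        rcases eq_or_ne j k with rfl | hj
        · exact le_rfl
        · simpa [hj] using (hle' j).1.trans ((hmax j).trans (hle' k).2)
      · simpa using hpos.trans_le (hle' k).2
      · intro t
        rcases eq_or_ne t k with rfl | ht
        · exact (mul_comm _ _).le
        · simpa [ht] using mul_le_mul' (hle' k).2 (hle' t).1
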